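/- Let $z_0 = -\frac{u\,\varphi(\lambda)}{p}$ where $\lambda = \prod_{n \ge 0}(1 - u^{p^n}/p)$ and $\varphi(u) = u^p$. Then $v_p(z_0|_{u=p}) = 0$, $v_p\big(\tfrac{dz_0}{du}\big|_{u=p}\big) = -1$, and for $1 < n < p$, $v_p\big(\tfrac{d^n z_0}{du^n}\big|_{u=p}\big) = p - n$. -/

import Mathlib

open scoped Topology

/-- The function `u ↦ φ^i(λ)(u) = ∏_{n ≥ i} (1 - u^{p^n}/p)` on `ℚ_p`. -/
noncomputable def phiLambda (p : ℕ) [Fact p.Prime] (i : ℕ) : ℚ_[p] → ℚ_[p] :=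
  fun u => ∏' n : ℕ, (1 - u ^ (p ^ (n + i)) / (p : ℚ_[p]))

/-- `z₀ = -(u · φ(λ))/p`. -/
noncomputable def zZero (p : ℕ) [Fact p.Prime] : ℚ_[p] → ℚ_[p] :=
  fun u => -(u * phiLambda p 1 u) / (p : ℚ_[p])


open Polynomial Filter in
lemma limit_coeffs (p : ℕ) [Fact p.Prime] (P : ℕ → ℤ[X]) (e : ℕ → ℕ) (he : StrictMono e)
    (hP : ∀ N, C ((p : ℤ) ^ e N) ∣ P (N + 1) - P N) :
    ∃ c : ℕ → ℚ_[p], (∀ k, ‖c k‖ ≤ 1) ∧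
      (∀ N k, ‖c k - ((P N).coeff k : ℚ_[p])‖ ≤ ((p : ℝ)⁻¹) ^ e N) ∧
      ∀ y : ℚ_[p], ‖y‖ < 1 → ∀ a, Tendsto (fun N => aeval y (P N)) atTop (𝓝 a) →
        HasSum (fun k => c k * y ^ k) a := by
  have hp1 : (1 : ℝ) < p := by exact_mod_cast (Fact.out : p.Prime).one_lt
  have hr0 : (0 : ℝ) ≤ (p : ℝ)⁻¹ := by positivity
  have hr1 : (p : ℝ)⁻¹ < 1 := inv_lt_one_of_one_lt₀ hp1
  have hdiv : ∀ N d, C ((p : ℤ) ^ e N) ∣ P (N + d) - P N := by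
    intro N d
    induction d with
    | zero => simp
    | succ d ih =>
      have h1 : C ((p : ℤ) ^ e N) ∣ P (N + d + 1) - P (N + d) :=
        (_root_.map_dvd C (pow_dvd_pow _ (he.monotone (Nat.le_add_right N d)))).trans (hP _)
      have := dvd_add h1 ih
      simpa [add_assoc] using this
  have hnorm : ∀ N d k, ‖((P (N + d)).coeff k : ℚ_[p]) - ((P N).coeff k : ℚ_[p])‖
      ≤ ((p : ℝ)⁻¹) ^ e N := by
    intro N d k
    obtain ⟨q, hq⟩ := hdiv N d
    have : (P (N + d)).coeff k - (P N).coeff k = (p : ℤ) ^ e N * q.coeff k := by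
      rw [← coeff_sub, hq, coeff_C_mul]
    rw [← Int.cast_sub, this]
    push_cast
    rw [norm_mul, norm_pow, Padic.norm_p]
    exact mul_le_of_le_one_right (by positivity) (Padic.norm_int_le_one _)
  have hten : Tendsto (fun N => ((p : ℝ)⁻¹) ^ e N) atTop (𝓝 0) :=
    (tendsto_pow_atTop_nhds_zero_of_lt_one hr0 hr1).comp he.tendsto_atTop
  have hc : ∀ k, ∃ c : ℚ_[p], Tendsto (fun N => ((P N).coeff k : ℚ_[p])) atTop (𝓝 c) := by
    intro k
    apply cauchySeq_tendsto_of_complete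
    apply cauchySeq_of_le_tendsto_0' _ _ hten
    intro n m hnm
    obtain ⟨d, rfl⟩ := Nat.exists_eq_add_of_le hnm
    rw [dist_comm, dist_eq_norm]
    exact hnorm n d k
  choose c hc using hc
  have hc1 : ∀ k, ‖c k‖ ≤ 1 := fun k =>
    le_of_tendsto (hc k).norm (Eventually.of_forall fun N => Padic.norm_int_le_one _)
  have hc2 : ∀ N k, ‖c k - ((P N).coeff k : ℚ_[p])‖ ≤ ((p : ℝ)⁻¹) ^ e N := by
    intro N k
    refine le_of_tendsto ((hc k).sub_const _).norm ?_
    filter_upwards [eventually_ge_atTop N] with M hM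
    obtain ⟨d, rfl⟩ := Nat.exists_eq_add_of_le hM
    exact hnorm N d k
  refine ⟨c, hc1, hc2, fun y hy a ha => ?_⟩
  have hg := summable_geometric_of_lt_one (norm_nonneg y) hy
  have hs : Summable (fun k => c k * y ^ k) := by
    refine Summable.of_norm_bounded hg fun k => ?_
    rw [norm_mul, norm_pow]
    exact mul_le_of_le_one_left (by positivity) (hc1 k)
  have hlim : Tendsto (fun N => aeval y (P N)) atTop (𝓝 (∑' k, c k * y ^ k)) := by
    rw [tendsto_iff_norm_sub_tendsto_zero]
    refine squeeze_zero (fun _ => norm_nonneg _)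
      (g := fun N => ((p : ℝ)⁻¹) ^ e N * ∑' k, ‖y‖ ^ k) (fun N => ?_) ?_
    · have h1 : HasSum (fun k => ((P N).coeff k : ℚ_[p]) * y ^ k) (aeval y (P N)) := by
        rw [aeval_eq_sum_range]
        simp only [zsmul_eq_mul]
        apply hasSum_sum_of_ne_finset_zero
        intro k hk
        rw [coeff_eq_zero_of_natDegree_lt (by simpa using hk)]
        simp
      rw [← norm_neg, neg_sub]
      have h2 := hs.hasSum.sub h1
      rw [← h2.tsum_eq]
      refine tsum_of_norm_bounded (hg.hasSum.mul_left _) fun k => ?_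
      rw [← sub_mul, norm_mul, norm_pow]
      exact mul_le_mul_of_nonneg_right (hc2 N k) (by positivity)
    · simpa using hten.mul_const (∑' k, ‖y‖ ^ k)
  rw [tendsto_nhds_unique ha hlim]
  exact hs.hasSum

open Polynomial in
/-- Recentred partial products. -/
noncomputable def partP (p : ℕ) (N : ℕ) : ℤ[X] :=
  -(1 + X) * ∏ n ∈ Finset.range N, (1 - C ((p : ℤ) ^ (p ^ (n + 1) - 1)) * (1 + X) ^ (p ^ (n + 1)))

open Polynomial Filter in
lemma partP_tendsto (p : ℕ) [Fact p.Prime] (y : ℚ_[p]) (hy : ‖y‖ < 1) :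
    Tendsto (fun N => aeval y (partP p N)) atTop (𝓝 (zZero p (p + p * y))) := by
  have hp0 : (p : ℚ_[p]) ≠ 0 := by exact_mod_cast (Fact.out : p.Prime).ne_zero
  have hp1 : (1 : ℝ) < p := by exact_mod_cast (Fact.out : p.Prime).one_lt
  have hr0 : (0 : ℝ) ≤ (p : ℝ)⁻¹ := by positivity
  have hr1 : (p : ℝ)⁻¹ < 1 := inv_lt_one_of_one_lt₀ hp1
  have hx : ‖1 + y‖ ≤ 1 := (Padic.nonarchimedean _ _).trans (by simp [hy.le])
  have hterm : ∀ n : ℕ, (1 : ℚ_[p]) - (p + p * y) ^ (p ^ (n + 1)) / p =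
      1 + -((p : ℚ_[p]) ^ (p ^ (n + 1) - 1) * (1 + y) ^ (p ^ (n + 1))) := by
    intro n
    have h : p ^ (n + 1) = (p ^ (n + 1) - 1) + 1 :=
      (Nat.sub_add_cancel (Nat.one_le_pow _ _ (Fact.out : p.Prime).pos)).symm
    rw [show (p : ℚ_[p]) + p * y = p * (1 + y) by ring, mul_pow]
    have h2 : (p : ℚ_[p]) ^ (p ^ (n + 1)) = (p : ℚ_[p]) ^ (p ^ (n + 1) - 1) * p := by
      rw [← pow_succ, ← h]
    rw [h2]
    field_simp
    ring
  have hm : Multipliable (fun n : ℕ => (1 : ℚ_[p]) - (p + p * y) ^ (p ^ (n + 1)) / p) := by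
    simp_rw [hterm]
    apply multipliable_one_add_of_summable
    refine Summable.of_nonneg_of_le (fun _ => norm_nonneg _) (fun n => ?_)
      (summable_geometric_of_lt_one hr0 hr1)
    rw [norm_neg, norm_mul, norm_pow, norm_pow, Padic.norm_p]
    refine (mul_le_of_le_one_right (by positivity) (pow_le_one₀ (norm_nonneg _) hx)).trans ?_
    apply pow_le_pow_of_le_one hr0 hr1.le
    have := Nat.lt_pow_self (n := n + 1) (Fact.out : p.Prime).one_lt
    omega
  have ht := (hm.hasProd.tendsto_prod_nat).const_mul (-(1 + y))
  have e1 : zZero p (p + p * y) = -(1 + y) * ∏' n : ℕ, (1 - (p + p * y) ^ (p ^ (n + 1)) / (p : ℚ_[p])) := by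
    unfold zZero phiLambda
    field_simp
  rw [e1]
  refine ht.congr fun N => ?_
  simp_rw [hterm]
  simp [partP, map_prod, sub_eq_add_neg]

open Polynomial in
lemma partP_dvd (p : ℕ) (N : ℕ) :
    C ((p : ℤ) ^ (p ^ (N + 1) - 1)) ∣ partP p (N + 1) - partP p N := by
  refine ⟨-(partP p N) * (1 + X) ^ (p ^ (N + 1)), ?_⟩
  unfold partP
  rw [Finset.prod_range_succ]
  ring

lemma exp_strictMono (p : ℕ) [Fact p.Prime] : StrictMono (fun N => p ^ (N + 1) - 1) := by
  apply strictMono_nat_of_lt_succ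
  intro n
  have h1 := Nat.pow_lt_pow_right (Fact.out : p.Prime).one_lt (Nat.lt_succ_self (n + 1))
  have h2 := Nat.one_le_pow (n + 1) p (Fact.out : p.Prime).pos
  simp only [Nat.succ_eq_add_one] at *
  omega

open Polynomial in
lemma partP_one_coeff (p k : ℕ) :
    (partP p 1).coeff k = -((Nat.choose 1 k : ℕ) : ℤ) + (p : ℤ) ^ (p - 1) * (Nat.choose (p + 1) k : ℕ) := by
  have : partP p 1 = -(1 + X) ^ 1 + C ((p : ℤ) ^ (p - 1)) * (1 + X) ^ (p + 1) := by
    simp only [partP, Finset.prod_range_one, zero_add, pow_one]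
    ring
  rw [this, coeff_add, coeff_neg, coeff_C_mul, coeff_one_add_X_pow, coeff_one_add_X_pow]

lemma main_formula (p : ℕ) [Fact p.Prime] : ∃ c : ℕ → ℚ_[p],
    (∀ k, ‖c k - ((partP p 1).coeff k : ℚ_[p])‖ ≤ ((p : ℝ)⁻¹) ^ (p ^ 2 - 1)) ∧
    ∀ n, iteratedDeriv n (zZero p) (p : ℚ_[p]) = (n.factorial : ℚ_[p]) * (c n / (p : ℚ_[p]) ^ n) := by
  obtain ⟨c, hc1, hc2, hc3⟩ := limit_coeffs p (partP p) _ (exp_strictMono p) (partP_dvd p)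
  refine ⟨c, fun k => hc2 1 k, fun n => ?_⟩
  have hp0 : (p : ℚ_[p]) ≠ 0 := by exact_mod_cast (Fact.out : p.Prime).ne_zero
  have hpp : (0 : ℝ) < p := by exact_mod_cast (Fact.out : p.Prime).pos
  have hF : HasFPowerSeriesOnBall (zZero p)
      (FormalMultilinearSeries.ofScalars ℚ_[p] (fun k => c k / (p : ℚ_[p]) ^ k)) (p : ℚ_[p])
      (((p : NNReal)⁻¹ : NNReal) : ENNReal) := by
    refine ⟨?_, ?_, ?_⟩
    · apply FormalMultilinearSeries.le_radius_of_bound _ 1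
      intro k
      rw [FormalMultilinearSeries.ofScalars_norm, norm_div, norm_pow, Padic.norm_p]
      push_cast
      rw [div_mul_cancel₀ _ (by positivity)]
      exact hc1 k
    · have : (0 : NNReal) < (p : NNReal)⁻¹ := by
        have : (0 : NNReal) < p := by exact_mod_cast (Fact.out : p.Prime).pos
        positivity
      exact_mod_cast this
    · intro w hw
      have hw2 : ‖w‖ < (p : ℝ)⁻¹ := by
        rw [Metric.eball_coe] at hw
        simpa using hw
      have hy : ‖w / p‖ < 1 := by
        rw [norm_div, Padic.norm_p, div_lt_one (by positivity)]
        exact hw2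
      have h := hc3 (w / p) hy _ (partP_tendsto p (w / p) hy)
      rw [mul_div_cancel₀ _ hp0] at h
      have hfun : (fun k => (FormalMultilinearSeries.ofScalars ℚ_[p]
          (fun k => c k / (p : ℚ_[p]) ^ k) k) fun _ => w) = fun k => c k * (w / p) ^ k := by
        funext k
        rw [FormalMultilinearSeries.ofScalars_apply_eq, smul_eq_mul, div_pow]
        ring
      rw [hfun]
      exact h
  have h := hF.factorial_smul 1 n
  rw [iteratedDeriv_eq_iteratedFDeriv, ← h, FormalMultilinearSeries.ofScalars_apply_eq]
  simp [nsmul_eq_mul]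

lemma norm_eq_of_close {p : ℕ} [Fact p.Prime] {a b : ℚ_[p]} (h : ‖a - b‖ < ‖b‖) : ‖a‖ = ‖b‖ := by
  have := Padic.add_eq_max_of_ne (p := p) (q := a - b) (r := b) h.ne
  rw [sub_add_cancel, max_eq_right h.le] at this
  exact this

lemma norm_fact (p : ℕ) [Fact p.Prime] {n : ℕ} (hn : n < p) : ‖(n.factorial : ℚ_[p])‖ = 1 := by
  rw [Padic.norm_natCast_eq_one_iff]
  exact (Nat.coprime_factorial_iff (Fact.out : p.Prime).ne_one).2 (by
    rw [(Fact.out : p.Prime).minFac_eq]; exact hn)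

lemma norm_choose (p : ℕ) [Fact p.Prime] {n : ℕ} (h1 : 1 < n) (hn : n < p) :
    ‖(((p + 1).choose n : ℕ) : ℚ_[p])‖ = (p : ℝ)⁻¹ := by
  have hp : p.Prime := Fact.out
  obtain ⟨m, rfl⟩ := Nat.exists_eq_add_of_le' h1
  obtain ⟨q, rfl⟩ : ∃ q, p = q + 1 := ⟨p - 1, by have := hp.pos; omega⟩
  have e : (q + 1 + 1).descFactorial (m + 2) = (q + 1 + 1) * ((q + 1) * q.descFactorial m) := by
    rw [Nat.succ_descFactorial_succ, Nat.succ_descFactorial_succ]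
  rw [Nat.descFactorial_eq_factorial_mul_choose] at e
  have e2 := congrArg (fun t : ℕ => ‖(t : ℚ_[q + 1])‖) e
  simp only [Nat.cast_mul, norm_mul] at e2
  have hd : ‖((q.descFactorial m : ℕ) : ℚ_[q + 1])‖ = 1 := by
    rw [Padic.norm_natCast_eq_one_iff]
    refine Nat.Coprime.coprime_dvd_right (m := q.factorial) ?_ ?_
    · exact ⟨_, ((mul_comm _ _).trans (Nat.factorial_mul_descFactorial (show m ≤ q by omega))).symm⟩
    · exact Padic.norm_natCast_eq_one_iff.1 (norm_fact (q + 1) (Nat.lt_succ_self q))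
  have hq : ‖((q + 1 + 1 : ℕ) : ℚ_[q + 1])‖ = 1 := by
    rw [Padic.norm_natCast_eq_one_iff]
    simp
  rw [norm_fact (q + 1) hn, hd, hq, Padic.norm_p] at e2
  simpa using e2

/-- `v_p(z₀|_{u=p}) = 0`, `v_p((dz₀/du)|_{u=p}) = -1`, and for
`1 < n < p`, `v_p((d^n z₀/du^n)|_{u=p}) = p - n`; stated via the `p`-adic norm
(`v_p(x) = k` iff `‖x‖ = p^{-k}`). -/
theorem stmt5 (p : ℕ) [Fact p.Prime] :
    ‖zZero p (p : ℚ_[p])‖ = 1 ∧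
    ‖deriv (zZero p) (p : ℚ_[p])‖ = (p : ℝ) ∧
    ∀ n : ℕ, 1 < n → n < p →
      ‖iteratedDeriv n (zZero p) (p : ℚ_[p])‖ = (p : ℝ) ^ ((n : ℤ) - (p : ℤ)) := by
  have hp : p.Prime := Fact.out
  have hp1 : (1 : ℝ) < p := by exact_mod_cast hp.one_lt
  have hr0 : (0 : ℝ) < (p : ℝ)⁻¹ := by positivity
  have hr1 : (p : ℝ)⁻¹ < 1 := inv_lt_one_of_one_lt₀ hp1
  obtain ⟨c, hc, hD⟩ := main_formula p
  have hsq : p + 1 ≤ p ^ 2 - 1 := by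
    have h2 := hp.two_le
    have : p + 2 ≤ p ^ 2 := by nlinarith
    omega
  have hsmall : ∀ k, ‖c k - ((partP p 1).coeff k : ℚ_[p])‖ < ((p : ℝ)⁻¹) ^ p := fun k =>
    (hc k).trans_lt (pow_lt_pow_right_of_lt_one₀ hr0 hr1 hsq)
  have hunit : ∀ m : ℕ, ‖(-1 : ℚ_[p]) + (p : ℚ_[p]) ^ (p - 1) * m‖ = 1 := by
    intro m
    rw [norm_eq_of_close (b := (-1 : ℚ_[p]))]
    · simp
    · have h2 := hp.two_le
      rw [add_sub_cancel_left, norm_mul, norm_pow, Padic.norm_p, norm_neg, norm_one]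
      refine (mul_le_of_le_one_right (by positivity) ?_).trans_lt
        (pow_lt_one₀ hr0.le hr1 (by omega))
      exact_mod_cast Padic.norm_int_le_one (p := p) (m : ℤ)
  have hc01 : ∀ k, k ≤ 1 → ‖c k‖ = 1 := by
    intro k hk
    have h1 : ‖((partP p 1).coeff k : ℚ_[p])‖ = 1 := by
      rw [partP_one_coeff]
      have : Nat.choose 1 k = 1 := by interval_cases k <;> rfl
      rw [this]
      push_cast
      exact hunit _
    rw [norm_eq_of_close (b := ((partP p 1).coeff k : ℚ_[p])), h1]
    rw [h1]
    exact (hsmall k).trans_le (pow_le_one₀ hr0.le hr1.le)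
  refine ⟨?_, ?_, ?_⟩
  · have := hD 0
    rw [iteratedDeriv_zero] at this
    rw [this]
    simp [hc01]
  · have := hD 1
    rw [iteratedDeriv_one] at this
    rw [this]
    simp [hc01]
  · intro n h1 hn
    have hb : ‖((partP p 1).coeff n : ℚ_[p])‖ = ((p : ℝ)⁻¹) ^ p := by
      rw [partP_one_coeff, Nat.choose_eq_zero_of_lt h1]
      push_cast
      rw [neg_zero, zero_add, norm_mul, norm_pow, Padic.norm_p, norm_choose p h1 hn, ← pow_succ,
        Nat.sub_add_cancel hp.one_le]
    have hcn := norm_eq_of_close (a := c n) (b := ((partP p 1).coeff n : ℚ_[p])) (by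
      rw [hb]; exact hsmall n)
    rw [hD n, norm_mul, norm_div, norm_pow, Padic.norm_p, norm_fact p hn, hcn, hb, one_mul,
      zpow_sub₀ (by positivity), zpow_natCast, zpow_natCast, inv_pow, inv_pow]
    field_simp
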